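/- arXiv:2410.21619 — 2 statements merged into one kernel-verified Lean document; each statement's English description precedes it below -/
import Mathlib

section
/- Let P, Q be real numbers with P > 0, Q > 0 and D := P² - 4Q > 0, let α := (P + √D)/2, and let U_n be the Lucas sequence of the first kind with parameters (P,Q), i.e. U_0 = 0, U_1 = 1, U_n = P·U_{n-1} - Q·U_{n-2}. Then for every positive integer k, ∑_{n=1}^{∞} L( U_k² · Q^{kn} / U_{k(n+1)}² ) = L( Q^k / α^{2k} ). -/
/-- The Rogers dilogarithm on `[0,1]`: `L(x) = Li₂(x) + (1/2)·log x · log (1-x)`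
for `0 < x < 1`, with `L 0 = 0` and `L 1 = π²/6`. -/
noncomputable def rogersL (x : ℝ) : ℝ :=
  if x = 0 then 0
  else if x = 1 then Real.pi ^ 2 / 6
  else (∑' n : ℕ, x ^ (n + 1) / ((n : ℝ) + 1) ^ 2) + 1 / 2 * Real.log x * Real.log (1 - x)

/-- Lucas sequence of the first kind: `U 0 = 0`, `U 1 = 1`, `U (n+2) = P·U (n+1) - Q·U n`. -/
noncomputable def lucasU (P Q : ℝ) : ℕ → ℝ
  | 0 => 0
  | 1 => 1
  | n + 2 => P * lucasU P Q (n + 1) - Q * lucasU P Q n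

/-- Lucas sequence of the second kind: `V 0 = 2`, `V 1 = P`, `V (n+2) = P·V (n+1) - Q·V n`. -/
noncomputable def lucasV (P Q : ℝ) : ℕ → ℝ
  | 0 => 2
  | 1 => P
  | n + 2 => P * lucasV P Q (n + 1) - Q * lucasV P Q n

open Filter Topology Set

theorem hasDerivAt_dilog_series {x : ℝ} (hx : 0 < x) (hx1 : x < 1) :
    HasDerivAt (fun y : ℝ => ∑' n : ℕ, y ^ (n + 1) / ((n : ℝ) + 1) ^ 2)
      (-Real.log (1 - x) / x) x := by
  obtain ⟨r, hxr, hr1⟩ := exists_between hx1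
  have hr0 : 0 < r := hx.trans hxr
  have key : HasDerivAt (fun y : ℝ => ∑' n : ℕ, y ^ (n + 1) / ((n : ℝ) + 1) ^ 2)
      (∑' n : ℕ, x ^ n / ((n : ℝ) + 1)) x := by
    refine hasDerivAt_tsum_of_isPreconnected (u := fun n : ℕ => r ^ n) (t := Ioo (-r) r) (y₀ := 0)
      (summable_geometric_of_lt_one hr0.le hr1) isOpen_Ioo isPreconnected_Ioo
      (g' := fun n y => y ^ n / ((n : ℝ) + 1)) ?_ ?_ ⟨by linarith, hr0⟩ ?_ ⟨by linarith, hxr⟩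
    · intro n y _
      have h := (hasDerivAt_pow (n + 1) y).div_const (((n : ℝ) + 1) ^ 2)
      refine h.congr_deriv ?_
      have : (n : ℝ) + 1 ≠ 0 := by positivity
      push_cast
      field_simp
    · intro n y hy
      have hyr : |y| ≤ r := abs_le.2 ⟨hy.1.le, hy.2.le⟩
      rw [Real.norm_eq_abs, abs_div, abs_pow, abs_of_pos (by positivity : (0 : ℝ) < n + 1)]
      calc |y| ^ n / ((n : ℝ) + 1) ≤ |y| ^ n :=
            div_le_self (by positivity) (by linarith [Nat.cast_nonneg (α := ℝ) n])
        _ ≤ r ^ n := by gcongr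
    · simp
  convert key using 1
  have h := (Real.hasSum_pow_div_log_of_abs_lt_one (x := x) (abs_lt.2 ⟨by linarith, hx1⟩)).div_const x
  rw [← h.tsum_eq]
  congr 1
  ext n
  field_simp
  ring

theorem continuousAt_zero_dilog_series :
    ContinuousAt (fun y : ℝ => ∑' n : ℕ, y ^ (n + 1) / ((n : ℝ) + 1) ^ 2) 0 := by
  refine ContinuousOn.continuousAt (s := Icc (-(1 / 2)) (1 / 2)) ?_
    (Icc_mem_nhds (by norm_num) (by norm_num))
  refine continuousOn_tsum (u := fun n : ℕ => (1 / 2 : ℝ) ^ n) (fun n => by fun_prop)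
    (summable_geometric_of_lt_one (by norm_num) (by norm_num)) ?_
  intro n y hy
  have hyr : |y| ≤ 1 / 2 := abs_le.2 ⟨hy.1, hy.2⟩
  have h1 : (1 : ℝ) ≤ ((n : ℝ) + 1) ^ 2 := by nlinarith [Nat.cast_nonneg (α := ℝ) n]
  rw [Real.norm_eq_abs, abs_div, abs_pow, abs_of_pos (by positivity : (0 : ℝ) < (n + 1) ^ 2)]
  calc |y| ^ (n + 1) / ((n : ℝ) + 1) ^ 2 ≤ |y| ^ (n + 1) := div_le_self (by positivity) h1
    _ ≤ (1 / 2) ^ (n + 1) := by gcongr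
    _ ≤ (1 / 2) ^ n := pow_le_pow_of_le_one (by norm_num) (by norm_num) (by omega)

theorem rogersL_zero : rogersL 0 = 0 := by simp [rogersL]

theorem rogersL_of_ne_one {x : ℝ} (hx1 : x ≠ 1) :
    rogersL x = (∑' n : ℕ, x ^ (n + 1) / ((n : ℝ) + 1) ^ 2)
      + 1 / 2 * (Real.log x * Real.log (1 - x)) := by
  by_cases hx : x = 0
  · simp [hx, rogersL]
  · simp only [rogersL, if_neg hx, if_neg hx1]
    ring

theorem rogersL_nonneg {x : ℝ} (hx : 0 < x) (hx1 : x < 1) : 0 ≤ rogersL x := by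
  rw [rogersL_of_ne_one hx1.ne]
  have h1 := Real.log_neg hx hx1
  have h2 := Real.log_neg (x := 1 - x) (by linarith) (by linarith)
  have h3 := mul_pos_of_neg_of_neg h1 h2
  have h4 : 0 ≤ ∑' n : ℕ, x ^ (n + 1) / ((n : ℝ) + 1) ^ 2 :=
    tsum_nonneg fun n => by positivity
  linarith

theorem hasDerivAt_rogersL {x : ℝ} (hx : 0 < x) (hx1 : x < 1) :
    HasDerivAt rogersL (-(Real.log (1 - x) / x + Real.log x / (1 - x)) / 2) x := by
  have h1 : HasDerivAt (fun y : ℝ => 1 - y) (-1) x := by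
    simpa using (hasDerivAt_id x).const_sub 1
  have h := (hasDerivAt_dilog_series hx hx1).add
    (((Real.hasDerivAt_log hx.ne').mul (h1.log (by linarith))).const_mul (1 / 2))
  have h' := h.congr_of_eventuallyEq (f₁ := rogersL) (by
    filter_upwards [eventually_ne_nhds hx1.ne] with y hy
    simpa using rogersL_of_ne_one hy)
  refine h'.congr_deriv ?_
  have : 1 - x ≠ 0 := by linarith
  field_simp
  ring

theorem HasDerivAt.rogersL_comp {g : ℝ → ℝ} {g' t : ℝ} (hg : HasDerivAt g g' t)
    (h0 : 0 < g t) (h1 : g t < 1) :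
    HasDerivAt (fun s => rogersL (g s))
      (-(Real.log (1 - g t) / g t + Real.log (g t) / (1 - g t)) / 2 * g') t :=
  (hasDerivAt_rogersL h0 h1).comp t hg

theorem continuousAt_log_mul_log_one_sub :
    ContinuousAt (fun x : ℝ => Real.log x * Real.log (1 - x)) 0 := by
  have h1 : HasDerivAt (fun y : ℝ => Real.log (1 - y)) (-1) 0 := by
    have := ((hasDerivAt_id (0 : ℝ)).const_sub 1).log (by simp)
    simpa using this
  have hO : (fun y : ℝ => Real.log (1 - y)) =O[𝓝 0] fun y => y := by
    simpa using h1.isBigO_sub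
  have hO' := (Asymptotics.isBigO_refl (fun y : ℝ => Real.log y) (𝓝 0)).mul hO
  have ht : Tendsto (fun y : ℝ => Real.log y * y) (𝓝 0) (𝓝 0) := by
    have := Real.continuous_mul_log.tendsto 0
    simpa [mul_comm] using this
  simpa [ContinuousAt] using hO'.trans_tendsto ht

theorem continuousAt_rogersL {x : ℝ} (hx : 0 ≤ x) (hx1 : x < 1) : ContinuousAt rogersL x := by
  rcases hx.eq_or_lt with rfl | hx
  · refine (continuousAt_zero_dilog_series.add
      (continuousAt_log_mul_log_one_sub.const_mul (1 / 2))).congr ?_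
    filter_upwards [eventually_ne_nhds (zero_ne_one (α := ℝ))] with y hy
    simpa using (rogersL_of_ne_one hy).symm
  · exact (hasDerivAt_rogersL hx hx1).continuousAt

/-- The function `x ↦ L(x) + L(1 - x)` is constant on `(0, 1)`. -/
theorem rogersL_add_rogersL_one_sub {x y : ℝ} (hx : 0 < x) (hx1 : x < 1) (hy : 0 < y)
    (hy1 : y < 1) : rogersL x + rogersL (1 - x) = rogersL y + rogersL (1 - y) := by
  have hd : ∀ z ∈ Ioo (0 : ℝ) 1, HasDerivAt (fun z => rogersL z + rogersL (1 - z)) 0 z := by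
    intro z hz
    have h1 : HasDerivAt (fun y : ℝ => 1 - y) (-1) z := by
      simpa using (hasDerivAt_id z).const_sub 1
    have h2 := h1.rogersL_comp (by linarith [hz.2]) (by linarith [hz.1])
    refine ((hasDerivAt_rogersL hz.1 hz.2).add h2).congr_deriv ?_
    rw [sub_sub_cancel]
    ring
  exact isOpen_Ioo.is_const_of_deriv_eq_zero isPreconnected_Ioo
    (fun z hz => (hd z hz).differentiableAt.differentiableWithinAt)
    (fun z hz => (hd z hz).deriv) ⟨hx, hx1⟩ ⟨hy, hy1⟩

/-- Abel's five-term relation. -/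
theorem rogersL_five_term {x y : ℝ} (hx : 0 < x) (hx1 : x < 1) (hy : 0 < y) (hy1 : y < 1) :
    rogersL x + rogersL y = rogersL (x * y) + rogersL (x * (1 - y) / (1 - x * y))
      + rogersL (y * (1 - x) / (1 - x * y)) := by
  have hbound : ∀ t : ℝ, 0 ≤ t → t < 1 → 0 < 1 - t * y := fun t ht ht1 => by nlinarith
  have hA1 : ∀ t : ℝ, 0 ≤ t → t < 1 →
      1 - t * (1 - y) / (1 - t * y) = (1 - t) / (1 - t * y) := fun t ht ht1 => by
    rw [eq_div_iff (hbound t ht ht1).ne', sub_mul, div_mul_cancel₀ _ (hbound t ht ht1).ne']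
    ring
  have hB1 : ∀ t : ℝ, 0 ≤ t → t < 1 →
      1 - y * (1 - t) / (1 - t * y) = (1 - y) / (1 - t * y) := fun t ht ht1 => by
    rw [eq_div_iff (hbound t ht ht1).ne', sub_mul, div_mul_cancel₀ _ (hbound t ht ht1).ne']
    ring
  have hAlt : ∀ t : ℝ, 0 ≤ t → t < 1 → t * (1 - y) / (1 - t * y) < 1 := fun t ht ht1 => by
    have : 0 < (1 - t) / (1 - t * y) := div_pos (by linarith) (hbound t ht ht1)
    linarith [hA1 t ht ht1]
  have hBlt : ∀ t : ℝ, 0 ≤ t → t < 1 → y * (1 - t) / (1 - t * y) < 1 := fun t ht ht1 => by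
    have : 0 < (1 - y) / (1 - t * y) := div_pos (by linarith) (hbound t ht ht1)
    linarith [hB1 t ht ht1]
  set f : ℝ → ℝ := fun t => rogersL t + rogersL y - (rogersL (t * y)
    + rogersL (t * (1 - y) / (1 - t * y)) + rogersL (y * (1 - t) / (1 - t * y))) with hf
  have hcont : ContinuousOn f (Icc 0 x) := by
    intro t ht
    have ht1 : t < 1 := ht.2.trans_lt hx1
    have hb := hbound t ht.1 ht1
    refine ContinuousAt.continuousWithinAt ?_
    have c1 := continuousAt_rogersL ht.1 ht1
    have c2 : ContinuousAt (fun t => rogersL (t * y)) t :=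
      ContinuousAt.comp (f := fun t => t * y)
        (continuousAt_rogersL (mul_nonneg ht.1 hy.le) (by linarith)) (by fun_prop)
    have c3 : ContinuousAt (fun t => rogersL (t * (1 - y) / (1 - t * y))) t :=
      ContinuousAt.comp (f := fun t => t * (1 - y) / (1 - t * y))
        (continuousAt_rogersL (div_nonneg (mul_nonneg ht.1 (by linarith)) hb.le)
          (hAlt t ht.1 ht1)) (by fun_prop (disch := exact hb.ne'))
    have c4 : ContinuousAt (fun t => rogersL (y * (1 - t) / (1 - t * y))) t :=
      ContinuousAt.comp (f := fun t => y * (1 - t) / (1 - t * y))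
        (continuousAt_rogersL (div_nonneg (mul_nonneg hy.le (by linarith)) hb.le)
          (hBlt t ht.1 ht1)) (by fun_prop (disch := exact hb.ne'))
    exact (c1.add continuousAt_const).sub ((c2.add c3).add c4)
  have hder : ∀ t ∈ Ioo 0 x, HasDerivAt f 0 t := by
    intro t ht
    have ht0 : 0 < t := ht.1
    have ht1 : t < 1 := ht.2.trans hx1
    have hb := hbound t ht0.le ht1
    have hy1' : 0 < 1 - y := by linarith
    have ht1' : 0 < 1 - t := by linarith
    have hid := hasDerivAt_id' t
    have dxy : HasDerivAt (fun t => t * y) y t := by simpa using hid.mul_const y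
    have dden : HasDerivAt (fun t => 1 - t * y) (-y) t := by simpa using dxy.const_sub 1
    have dA : HasDerivAt (fun t => t * (1 - y) / (1 - t * y)) ((1 - y) / (1 - t * y) ^ 2) t := by
      exact ((hid.mul_const (1 - y)).div dden hb.ne').congr_deriv (by ring)
    have dB : HasDerivAt (fun t => y * (1 - t) / (1 - t * y))
        (-(y * (1 - y)) / (1 - t * y) ^ 2) t := by
      exact (((hid.const_sub 1).const_mul y).div dden hb.ne').congr_deriv (by ring)
    have d1 := hasDerivAt_rogersL ht0 ht1
    have d2 := dxy.rogersL_comp (by positivity) (by linarith)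
    have d3 := dA.rogersL_comp (by positivity) (hAlt t ht0.le ht1)
    have d4 := dB.rogersL_comp (by positivity) (hBlt t ht0.le ht1)
    refine ((d1.add_const (rogersL y)).sub ((d2.add d3).add d4)).congr_deriv ?_
    rw [hA1 t ht0.le ht1, hB1 t ht0.le ht1, Real.log_div ht1'.ne' hb.ne',
      Real.log_div hy1'.ne' hb.ne', Real.log_div (by positivity) hb.ne',
      Real.log_div (by positivity) hb.ne', Real.log_mul ht0.ne' hy.ne',
      Real.log_mul ht0.ne' hy1'.ne', Real.log_mul hy.ne' ht1'.ne']
    have e1 := hb.ne'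
    have e2 := hy1'.ne'
    have e3 := ht1'.ne'
    field_simp
    ring
  obtain ⟨c, hc, hslope⟩ := exists_hasDerivAt_eq_slope f (fun _ => 0) hx hcont hder
  have h0 : f 0 = 0 := by simp [hf, rogersL_zero]
  have hfx : f x = 0 := by
    rw [h0] at hslope
    have : x - 0 ≠ 0 := by simpa using hx.ne'
    field_simp at hslope
    linarith
  exact sub_eq_zero.1 hfx

theorem rogersL_telescope {q : ℝ} (hq : 0 < q) (hq1 : q < 1) {n : ℕ} (hn : 0 < n) :
    rogersL ((1 - q) ^ 2 * q ^ n / (1 - q ^ (n + 1)) ^ 2)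
      = (rogersL (q ^ n * (1 - q) / (1 - q ^ (n + 1))) + rogersL ((1 - q) / (1 - q ^ (n + 1))))
        - (rogersL (q ^ (n + 1) * (1 - q) / (1 - q ^ (n + 2)))
          + rogersL ((1 - q) / (1 - q ^ (n + 2)))) := by
  have hp : 0 < q ^ n := by positivity
  have hp1 : q ^ n < 1 := pow_lt_one₀ hq.le hq1 hn.ne'
  have hpq : 0 < 1 - q ^ n * q := by nlinarith
  have hpqq : 0 < 1 - q ^ n * q ^ 2 := by nlinarith
  simp only [pow_add, pow_one]
  set p := q ^ n
  have hq' : 0 < 1 - q := by linarith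
  have hp' : 0 < 1 - p := by linarith
  have hqp : 1 - q * p ≠ 0 := by linarith
  have hqqp : 1 - q ^ 2 * p ≠ 0 := by linarith
  have h := rogersL_five_term (x := p * (1 - q) / (1 - p * q)) (y := (1 - q) / (1 - p * q))
    (by positivity) (by rw [div_lt_one hpq]; linarith) (by positivity)
    (by rw [div_lt_one hpq]; nlinarith)
  have e0 : p * (1 - q) / (1 - p * q) * ((1 - q) / (1 - p * q))
      = (1 - q) ^ 2 * p / (1 - p * q) ^ 2 := by
    field_simp
  have e1 : 1 - (1 - q) ^ 2 * p / (1 - p * q) ^ 2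
      = (1 - p) * (1 - p * q ^ 2) / (1 - p * q) ^ 2 := by
    field_simp
    ring
  have e2 : 1 - (1 - q) / (1 - p * q) = q * (1 - p) / (1 - p * q) := by
    field_simp
    ring
  have e3 : 1 - p * (1 - q) / (1 - p * q) = (1 - p) / (1 - p * q) := by
    field_simp
    ring
  rw [e0, e1, e2, e3] at h
  have e4 : p * (1 - q) / (1 - p * q) * (q * (1 - p) / (1 - p * q))
      / ((1 - p) * (1 - p * q ^ 2) / (1 - p * q) ^ 2) = p * q * (1 - q) / (1 - p * q ^ 2) := by
    field_simp
  have e5 : (1 - q) / (1 - p * q) * ((1 - p) / (1 - p * q))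
      / ((1 - p) * (1 - p * q ^ 2) / (1 - p * q) ^ 2) = (1 - q) / (1 - p * q ^ 2) := by
    field_simp
  rw [e4, e5] at h
  linarith

theorem hasSum_rogersL_geometric {q : ℝ} (hq : 0 < q) (hq1 : q < 1) :
    HasSum (fun n : ℕ => rogersL ((1 - q) ^ 2 * q ^ (n + 1) / (1 - q ^ (n + 2)) ^ 2))
      (rogersL q) := by
  have hq' : 0 < 1 - q := by linarith
  set g : ℕ → ℝ := fun n => rogersL (q ^ (n + 1) * (1 - q) / (1 - q ^ (n + 2)))
    + rogersL ((1 - q) / (1 - q ^ (n + 2))) with hg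
  have hterm : ∀ n : ℕ, rogersL ((1 - q) ^ 2 * q ^ (n + 1) / (1 - q ^ (n + 2)) ^ 2)
      = g n - g (n + 1) := fun n => rogersL_telescope hq hq1 n.succ_pos
  rw [hasSum_iff_tendsto_nat_of_nonneg]
  · simp only [hterm, Finset.sum_range_sub']
    have hpow : Tendsto (fun n : ℕ => q ^ n) atTop (𝓝 0) :=
      tendsto_pow_atTop_nhds_zero_of_lt_one hq.le hq1
    have hpow1 := (tendsto_add_atTop_iff_nat 1).2 hpow
    have hden : Tendsto (fun n : ℕ => 1 - q ^ (n + 2)) atTop (𝓝 1) := by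
      simpa using ((tendsto_add_atTop_iff_nat 2).2 hpow).const_sub 1
    have t1 : Tendsto (fun n : ℕ => q ^ (n + 1) * (1 - q) / (1 - q ^ (n + 2))) atTop (𝓝 0) := by
      have h := (hpow1.mul_const (1 - q)).div hden one_ne_zero
      rw [zero_mul, zero_div] at h
      exact h
    have t2 : Tendsto (fun n : ℕ => (1 - q) / (1 - q ^ (n + 2))) atTop (𝓝 (1 - q)) := by
      have h := (tendsto_const_nhds (x := 1 - q)).div hden one_ne_zero
      rw [div_one] at h
      exact h
    have t := ((continuousAt_rogersL le_rfl one_pos).tendsto.comp t1).add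
      ((continuousAt_rogersL hq'.le (by linarith)).tendsto.comp t2)
    have hlim : g 0 - (rogersL 0 + rogersL (1 - q)) = rogersL q := by
      have hne : 1 - q ^ 2 ≠ 0 := by nlinarith
      have e1 : q ^ (0 + 1) * (1 - q) / (1 - q ^ (0 + 2)) = q / (1 + q) := by
        simp only [zero_add, pow_one]
        field_simp
        ring
      have e2 : (1 - q) / (1 - q ^ (0 + 2)) = 1 - q / (1 + q) := by
        simp only [zero_add]
        field_simp
        ring
      have h := rogersL_add_rogersL_one_sub (x := q / (1 + q)) (y := q) (by positivity)
        (by rw [div_lt_one (by positivity)]; linarith) hq hq1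
      simp only [hg]
      rw [e1, e2, h, rogersL_zero]
      ring
    rw [← hlim]
    exact t.const_sub (g 0)
  · intro n
    have hp : 0 < q ^ (n + 1) := by positivity
    have hp1 : q ^ (n + 1) < 1 := pow_lt_one₀ hq.le hq1 n.succ_ne_zero
    rw [show q ^ (n + 2) = q ^ (n + 1) * q from pow_succ _ _]
    have hpq : 0 < 1 - q ^ (n + 1) * q := by nlinarith
    refine rogersL_nonneg (by positivity) ?_
    rw [div_lt_one (by positivity)]
    have hpqq : 0 < 1 - q ^ (n + 1) * q ^ 2 := by nlinarith
    nlinarith [mul_pos (sub_pos.2 hp1) hpqq]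

theorem lucasU_mul_sub (a b : ℝ) (n : ℕ) :
    lucasU (a + b) (a * b) n * (a - b) = a ^ n - b ^ n := by
  induction n using Nat.twoStepInduction with
  | zero => simp [lucasU]
  | one => simp [lucasU]
  | more n h0 h1 =>
    rw [lucasU, sub_mul, mul_assoc, mul_assoc, h0, h1]
    ring

theorem lucasU_quotient_eq {a b : ℝ} (hb : 0 < b) (hab : b < a) {k : ℕ} (hk : 0 < k) (n : ℕ) :
    lucasU (a + b) (a * b) k ^ 2 * (a * b) ^ (k * (n + 1))
        / lucasU (a + b) (a * b) (k * (n + 2)) ^ 2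
      = (1 - (b / a) ^ k) ^ 2 * ((b / a) ^ k) ^ (n + 1) / (1 - ((b / a) ^ k) ^ (n + 2)) ^ 2 := by
  have ha : 0 < a := hb.trans hab
  have hs : a - b ≠ 0 := by linarith
  have hU : ∀ m, lucasU (a + b) (a * b) m = (a ^ m - b ^ m) / (a - b) := fun m => by
    rw [← lucasU_mul_sub]
    field_simp
  have hlt : (b ^ k) ^ (n + 2) < (a ^ k) ^ (n + 2) := by
    rw [← pow_mul, ← pow_mul]
    exact pow_lt_pow_left₀ hab hb.le (by positivity)
  rw [hU, hU, div_pow b a k]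
  simp only [pow_mul, mul_pow a b k]
  have hA : 0 < a ^ k := by positivity
  set A := a ^ k
  set B := b ^ k
  have h1 : A ^ (n + 2) - B ^ (n + 2) ≠ 0 := by linarith
  have h2 : 1 - (B / A) ^ (n + 2) = (A ^ (n + 2) - B ^ (n + 2)) / A ^ (n + 2) := by
    rw [div_pow, one_sub_div (pow_ne_zero _ hA.ne')]
  rw [h2, mul_pow, div_pow B A (n + 1)]
  field_simp
  ring

theorem stmt_8 (P Q : ℝ) (hP : 0 < P) (hQ : 0 < Q) (hD : 0 < P ^ 2 - 4 * Q)
    (k : ℕ) (hk : 0 < k) :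
    ∑' n : ℕ, rogersL (lucasU P Q k ^ 2 * Q ^ (k * (n + 1)) / lucasU P Q (k * (n + 2)) ^ 2) =
      rogersL (Q ^ k / ((P + Real.sqrt (P ^ 2 - 4 * Q)) / 2) ^ (2 * k)) := by
  set s := Real.sqrt (P ^ 2 - 4 * Q) with hs
  have hs0 : 0 < s := Real.sqrt_pos.2 hD
  have hs2 : s ^ 2 = P ^ 2 - 4 * Q := Real.sq_sqrt hD.le
  obtain ⟨a, ha⟩ : ∃ a, a = (P + s) / 2 := ⟨_, rfl⟩
  obtain ⟨b, hb⟩ : ∃ b, b = (P - s) / 2 := ⟨_, rfl⟩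
  have hPab : P = a + b := by rw [ha, hb]; ring
  have hQab : Q = a * b := by rw [ha, hb]; linarith
  have hb0 : 0 < b := by rw [hb]; nlinarith
  have hab : b < a := by linarith
  have ha0 : 0 < a := hb0.trans hab
  have hq1 : (b / a) ^ k < 1 :=
    pow_lt_one₀ (by positivity) ((div_lt_one ha0).2 hab) hk.ne'
  rw [← ha, hPab, hQab]
  simp only [lucasU_quotient_eq hb0 hab hk]
  rw [(hasSum_rogersL_geometric (by positivity) hq1).tsum_eq]
  congr 1
  rw [div_pow, mul_pow, two_mul, pow_add]
  field_simp
end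

section
/- Let F_n denote the Fibonacci numbers and φ := (1+√5)/2 the golden ratio. Then for every positive integer k, ∑_{n=2}^{∞} L( F_{2k}² / F_{2kn}² ) = L( 1/φ^{4k} ). -/
open Filter Topology Set

/-- The formula defining `rogersL` away from `x = 1`; with `Real.log 0 = 0` it also vanishes at `0`. -/
noncomputable def rogersAux (x : ℝ) : ℝ :=
  (∑' n : ℕ, x ^ (n + 1) / ((n : ℝ) + 1) ^ 2) + 1 / 2 * Real.log x * Real.log (1 - x)

theorem rogersAux_zero : rogersAux 0 = 0 := by
  simp [rogersAux]

theorem rogersL_eq_rogersAux {x : ℝ} (hx : x ≠ 1) : rogersL x = rogersAux x := by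
  by_cases h : x = 0
  · subst h; simp [rogersL, rogersAux_zero]
  · simp [rogersL, rogersAux, h, hx]

theorem rogersAux_nonneg {x : ℝ} (h0 : 0 ≤ x) (h1 : x < 1) : 0 ≤ rogersAux x := by
  have hs : 0 ≤ ∑' n : ℕ, x ^ (n + 1) / ((n : ℝ) + 1) ^ 2 := tsum_nonneg fun n => by positivity
  have hl := mul_nonneg_of_nonpos_of_nonpos (Real.log_nonpos h0 h1.le)
    (Real.log_nonpos (by linarith : 0 ≤ 1 - x) (by linarith))
  unfold rogersAux
  linarith

theorem hasDerivAt_tsum_pow_div_sq {x : ℝ} (hx : |x| < 1) :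
    HasDerivAt (fun y : ℝ => ∑' n : ℕ, y ^ (n + 1) / ((n : ℝ) + 1) ^ 2)
      (∑' n : ℕ, x ^ n / ((n : ℝ) + 1)) x := by
  obtain ⟨r, hxr, hr1⟩ := exists_between hx
  have hr0 : 0 < r := (abs_nonneg x).trans_lt hxr
  refine hasDerivAt_tsum_of_isPreconnected (t := Ioo (-r) r) (u := fun n => r ^ n)
    (g := fun (n : ℕ) (y : ℝ) => y ^ (n + 1) / ((n : ℝ) + 1) ^ 2)
    (g' := fun (n : ℕ) (y : ℝ) => y ^ n / ((n : ℝ) + 1)) (y₀ := 0) (y := x)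
    (summable_geometric_of_lt_one hr0.le hr1) isOpen_Ioo isPreconnected_Ioo ?_ ?_ ?_ ?_ ?_
  · intro n y _
    have h := (hasDerivAt_pow (n + 1) y).div_const (((n : ℝ) + 1) ^ 2)
    refine h.congr_deriv ?_
    have : (n : ℝ) + 1 ≠ 0 := by positivity
    rw [Nat.add_sub_cancel]
    push_cast
    field_simp
  · intro n y hy
    rw [Real.norm_eq_abs, abs_div, abs_pow, abs_of_pos (by positivity : (0 : ℝ) < n + 1)]
    have h1 : |y| ^ n ≤ r ^ n := pow_le_pow_left₀ (abs_nonneg y) (abs_le.2 ⟨hy.1.le, hy.2.le⟩) n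
    exact (div_le_self (by positivity) (by linarith [Nat.cast_nonneg (α := ℝ) n])).trans h1
  · exact ⟨by linarith, hr0⟩
  · simp
  · exact abs_lt.1 hxr

theorem tsum_pow_div_eq_neg_log {x : ℝ} (h0 : x ≠ 0) (hx : |x| < 1) :
    ∑' n : ℕ, x ^ n / ((n : ℝ) + 1) = -Real.log (1 - x) / x := by
  have h := (Real.hasSum_pow_div_log_of_abs_lt_one hx).div_const x
  rw [← h.tsum_eq]
  refine tsum_congr fun n => ?_
  have : (n : ℝ) + 1 ≠ 0 := by positivity
  field_simp
  ring

theorem hasDerivAt_rogersAux {x : ℝ} (h0 : 0 < x) (h1 : x < 1) :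
    HasDerivAt rogersAux
      (-(1 / 2) * (Real.log (1 - x) / x + Real.log x / (1 - x))) x := by
  have hx : |x| < 1 := abs_lt.2 ⟨by linarith, h1⟩
  have hd := hasDerivAt_tsum_pow_div_sq hx
  rw [tsum_pow_div_eq_neg_log h0.ne' hx] at hd
  have h1x : 1 - x ≠ 0 := by linarith
  have hl := (((Real.hasDerivAt_log h0.ne').const_mul (1 / 2)).mul
    (((hasDerivAt_id x).const_sub 1).log h1x))
  refine (hd.add hl).congr_deriv ?_
  simp only [id]
  have := h0.ne'
  field_simp
  ring

theorem continuousAt_rogersAux_zero : ContinuousAt rogersAux 0 := by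
  have hd : HasDerivAt (fun x : ℝ => Real.log (1 - x)) (-1 / (1 - 0)) 0 :=
    ((hasDerivAt_id (0 : ℝ)).const_sub 1).log (by norm_num)
  have hs := continuousAt_dslope_same.2 hd.differentiableAt
  have hm := (Real.continuous_mul_log.continuousAt (x := 0)).mul hs
  refine ((hasDerivAt_tsum_pow_div_sq (x := 0) (by simp)).continuousAt.add
    (hm.const_mul (1 / 2))).congr (Eventually.of_forall fun x => ?_)
  by_cases h : x = 0
  · subst h; simp [rogersAux]
  · simp only [rogersAux, Pi.add_apply, Pi.mul_apply, dslope_of_ne _ h, slope_def_field,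
      sub_zero, Real.log_one]
    field_simp

theorem continuousAt_rogersAux {x : ℝ} (h0 : 0 ≤ x) (h1 : x < 1) : ContinuousAt rogersAux x := by
  rcases h0.eq_or_lt with rfl | h0
  · exact continuousAt_rogersAux_zero
  · exact (hasDerivAt_rogersAux h0 h1).continuousAt

/-- The reflection formula, with the constant `L(1)` left implicit. -/
theorem rogersAux_add_rogersAux_one_sub {x y : ℝ} (hx : x ∈ Ioo (0 : ℝ) 1)
    (hy : y ∈ Ioo (0 : ℝ) 1) :
    rogersAux x + rogersAux (1 - x) = rogersAux y + rogersAux (1 - y) := by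
  have hd : ∀ z ∈ Ioo (0 : ℝ) 1,
      HasDerivAt (fun t => rogersAux t + rogersAux (1 - t)) 0 z := by
    intro z hz
    have h2 := (hasDerivAt_rogersAux (x := 1 - z) (by linarith [hz.2]) (by linarith [hz.1])).comp z
      ((hasDerivAt_id z).const_sub 1)
    refine ((hasDerivAt_rogersAux hz.1 hz.2).add h2).congr_deriv ?_
    rw [sub_sub_cancel]
    ring
  exact isOpen_Ioo.is_const_of_deriv_eq_zero isPreconnected_Ioo
    (fun z hz => (hd z hz).differentiableAt.differentiableWithinAt)
    (fun z hz => (hd z hz).deriv) hx hy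

/-- Abel's five-term relation. -/
theorem rogersAux_five_term {x y : ℝ} (hx : x ∈ Ioo (0 : ℝ) 1) (hy : y ∈ Ioo (0 : ℝ) 1) :
    rogersAux x + rogersAux y = rogersAux (x * y) + rogersAux (x * (1 - y) / (1 - x * y)) +
      rogersAux (y * (1 - x) / (1 - x * y)) := by
  obtain ⟨hy0, hy1⟩ := hy
  have hy1' : 0 < 1 - y := by linarith
  let f : ℝ → ℝ := fun t => rogersAux t + rogersAux y - rogersAux (t * y) -
    rogersAux (t * (1 - y) / (1 - t * y)) - rogersAux (y * (1 - t) / (1 - t * y))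
  have hden : ∀ t : ℝ, 0 ≤ t → t < 1 → 0 < 1 - t * y := fun t h0 h1 => by nlinarith
  have hv : ∀ t : ℝ, 0 ≤ t → t < 1 → 1 - t * (1 - y) / (1 - t * y) = (1 - t) / (1 - t * y) :=
    fun t h0 h1 => by rw [one_sub_div (hden t h0 h1).ne']; ring
  have hw : ∀ t : ℝ, 0 ≤ t → t < 1 → 1 - y * (1 - t) / (1 - t * y) = (1 - y) / (1 - t * y) :=
    fun t h0 h1 => by rw [one_sub_div (hden t h0 h1).ne']; ring
  have hv1 : ∀ t : ℝ, 0 ≤ t → t < 1 → t * (1 - y) / (1 - t * y) < 1 := fun t h0 h1 => by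
    have := div_pos (by linarith : 0 < 1 - t) (hden t h0 h1)
    linarith [hv t h0 h1]
  have hw1 : ∀ t : ℝ, 0 ≤ t → t < 1 → y * (1 - t) / (1 - t * y) < 1 := fun t h0 h1 => by
    have := div_pos hy1' (hden t h0 h1)
    linarith [hw t h0 h1]
  have hcont : ContinuousOn f (Icc 0 x) := by
    intro t ht
    have h0 := ht.1
    have h1 : t < 1 := ht.2.trans_lt hx.2
    have hD := hden t h0 h1
    have h1t : 0 ≤ 1 - t := by linarith
    refine ContinuousAt.continuousWithinAt ?_
    have c1 := continuousAt_rogersAux h0 h1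
    have c2 : ContinuousAt (fun t => rogersAux (t * y)) t :=
      ContinuousAt.comp (f := fun t => t * y)
        (continuousAt_rogersAux (by positivity) (by linarith)) (by fun_prop)
    have c3 : ContinuousAt (fun t => rogersAux (t * (1 - y) / (1 - t * y))) t :=
      ContinuousAt.comp (f := fun t => t * (1 - y) / (1 - t * y))
        (continuousAt_rogersAux (by positivity) (hv1 t h0 h1))
        (ContinuousAt.div (by fun_prop) (by fun_prop) hD.ne')
    have c4 : ContinuousAt (fun t => rogersAux (y * (1 - t) / (1 - t * y))) t :=
      ContinuousAt.comp (f := fun t => y * (1 - t) / (1 - t * y))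
        (continuousAt_rogersAux (by positivity) (hw1 t h0 h1))
        (ContinuousAt.div (by fun_prop) (by fun_prop) hD.ne')
    exact (((c1.add continuousAt_const).sub c2).sub c3).sub c4
  have hderiv : ∀ t ∈ Ioo 0 x, HasDerivAt f 0 t := by
    intro t ht
    have h0 := ht.1
    have h1 : t < 1 := ht.2.trans hx.2
    have hD := hden t h0.le h1
    have h1t : 0 < 1 - t := by linarith
    have e1 : HasDerivAt (fun t : ℝ => t * y) y t := by
      simpa using (hasDerivAt_id t).mul_const y
    have e2 : HasDerivAt (fun t : ℝ => 1 - t * y) (-y) t := e1.const_sub 1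
    have e3 : HasDerivAt (fun t : ℝ => t * (1 - y)) (1 - y) t := by
      simpa using (hasDerivAt_id t).mul_const (1 - y)
    have e4 : HasDerivAt (fun t : ℝ => y * (1 - t)) (-y) t := by
      simpa using ((hasDerivAt_id t).const_sub 1).const_mul y
    have d1 := hasDerivAt_rogersAux h0 h1
    have d2 := (hasDerivAt_rogersAux (x := t * y) (by positivity) (by linarith)).comp t e1
    have d3 := (hasDerivAt_rogersAux (x := t * (1 - y) / (1 - t * y))
      (by positivity) (hv1 t h0.le h1)).comp t (e3.div e2 hD.ne')
    have d4 := (hasDerivAt_rogersAux (x := y * (1 - t) / (1 - t * y))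
      (by positivity) (hw1 t h0.le h1)).comp t (e4.div e2 hD.ne')
    refine ((((d1.add_const (rogersAux y)).sub d2).sub d3).sub d4).congr_deriv ?_
    rw [hv t h0.le h1, hw t h0.le h1, Real.log_div h1t.ne' hD.ne', Real.log_div hy1'.ne' hD.ne',
      Real.log_div (by positivity) hD.ne', Real.log_div (by positivity) hD.ne',
      Real.log_mul h0.ne' hy0.ne', Real.log_mul h0.ne' hy1'.ne', Real.log_mul hy0.ne' h1t.ne']
    generalize Real.log (1 - t * y) = lD
    generalize Real.log (1 - t) = l1t
    generalize Real.log (1 - y) = l1y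
    generalize Real.log t = lt
    generalize Real.log y = ly
    have := hD.ne'
    have := h1t.ne'
    have := hy1'.ne'
    field_simp
    ring
  obtain ⟨c, -, hc⟩ := exists_hasDerivAt_eq_slope f (fun _ => 0) hx.1 hcont hderiv
  have hx0 : x - 0 ≠ 0 := by linarith [hx.1]
  have hfx : f x = f 0 := by
    rw [eq_comm, div_eq_zero_iff] at hc
    exact sub_eq_zero.1 (hc.resolve_right hx0)
  simp only [f, zero_mul, sub_zero, div_one, mul_one, rogersAux_zero] at hfx
  linarith

/-- The consecutive difference produced by the five-term relation at
`q ^ n (1 - q) / (1 - q ^ (n + 1))` and `(1 - q) / (1 - q ^ (n + 1))`. -/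
theorem rogersAux_telescope {q : ℝ} (h0 : 0 < q) (h1 : q < 1) {n : ℕ} (hn : n ≠ 0) :
    rogersAux (q ^ n * (1 - q) ^ 2 / (1 - q ^ (n + 1)) ^ 2) =
      (rogersAux (q ^ n * (1 - q) / (1 - q ^ (n + 1))) +
        rogersAux ((1 - q) / (1 - q ^ (n + 1)))) -
      (rogersAux (q ^ (n + 1) * (1 - q) / (1 - q ^ (n + 2))) +
        rogersAux ((1 - q) / (1 - q ^ (n + 2)))) := by
  have hp0 : 0 < q ^ n := by positivity
  have hp1 : q ^ n < 1 := pow_lt_one₀ h0.le h1 hn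
  rw [pow_succ q n, pow_add q n 2]
  generalize q ^ n = p at hp0 hp1
  have hq : 0 < 1 - q := by linarith
  have hp : 0 < 1 - p := by linarith
  have ha : 0 < 1 - p * q := by nlinarith
  have hb : 0 < 1 - p * q ^ 2 := by nlinarith
  have hX : p * (1 - q) / (1 - p * q) ∈ Ioo (0 : ℝ) 1 :=
    ⟨by positivity, by rw [div_lt_one ha]; nlinarith⟩
  have hY : (1 - q) / (1 - p * q) ∈ Ioo (0 : ℝ) 1 :=
    ⟨by positivity, by rw [div_lt_one ha]; nlinarith⟩
  have h := rogersAux_five_term hX hY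
  have hprod : p * (1 - q) / (1 - p * q) * ((1 - q) / (1 - p * q)) =
      p * (1 - q) ^ 2 / (1 - p * q) ^ 2 := by
    field_simp
  have hX' : 1 - p * (1 - q) / (1 - p * q) = (1 - p) / (1 - p * q) := by
    rw [one_sub_div ha.ne']; ring
  have hY' : 1 - (1 - q) / (1 - p * q) = q * (1 - p) / (1 - p * q) := by
    rw [one_sub_div ha.ne']; ring
  have hXY : 1 - p * (1 - q) ^ 2 / (1 - p * q) ^ 2 =
      (1 - p) * (1 - p * q ^ 2) / (1 - p * q) ^ 2 := by
    rw [one_sub_div (pow_ne_zero 2 ha.ne')]; ring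
  have hv : p * (1 - q) / (1 - p * q) * (q * (1 - p) / (1 - p * q)) /
      ((1 - p) * (1 - p * q ^ 2) / (1 - p * q) ^ 2) = p * q * (1 - q) / (1 - p * q ^ 2) := by
    field_simp
  have hw : (1 - q) / (1 - p * q) * ((1 - p) / (1 - p * q)) /
      ((1 - p) * (1 - p * q ^ 2) / (1 - p * q) ^ 2) = (1 - q) / (1 - p * q ^ 2) := by
    generalize 1 - p * q = a at ha
    generalize 1 - p * q ^ 2 = b at hb
    field_simp
  rw [hprod, hX', hY', hXY, hv, hw] at h
  linarith

theorem hasSum_rogersL {q : ℝ} (h0 : 0 < q) (h1 : q < 1) :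
    HasSum (fun n : ℕ => rogersL (q ^ (n + 1) * (1 - q) ^ 2 / (1 - q ^ (n + 2)) ^ 2))
      (rogersL q) := by
  have hq : 0 < 1 - q := by linarith
  have hlt : ∀ n : ℕ, q ^ (n + 1) * (1 - q) ^ 2 / (1 - q ^ (n + 2)) ^ 2 < 1 := fun n => by
    have hp1 : q ^ (n + 1) < 1 := pow_lt_one₀ h0.le h1 (by omega)
    have hp0 : 0 < q ^ (n + 1) := by positivity
    rw [pow_succ q (n + 1)]
    generalize q ^ (n + 1) = p at hp0 hp1
    have ha : 0 < 1 - p * q := by nlinarith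
    rw [div_lt_one (by positivity)]
    nlinarith [mul_pos hq (sub_pos.2 hp1), mul_pos (sub_pos.2 hp1) (by nlinarith : 0 < 1 - p * q ^ 2)]
  let B : ℕ → ℝ := fun n => rogersAux (q ^ (n + 1) * (1 - q) / (1 - q ^ (n + 2))) +
    rogersAux ((1 - q) / (1 - q ^ (n + 2)))
  have hpow : ∀ m : ℕ, Tendsto (fun n : ℕ => q ^ (n + m)) atTop (𝓝 0) := fun m =>
    (tendsto_add_atTop_iff_nat m).2 (tendsto_pow_atTop_nhds_zero_of_lt_one h0.le h1)
  have hBlim : Tendsto B atTop (𝓝 (rogersAux 0 + rogersAux (1 - q))) := by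
    have hden : Tendsto (fun n : ℕ => 1 - q ^ (n + 2)) atTop (𝓝 1) := by
      simpa using (hpow 2).const_sub 1
    have hX : Tendsto (fun n : ℕ => q ^ (n + 1) * (1 - q) / (1 - q ^ (n + 2))) atTop (𝓝 0) := by
      simpa [Pi.div_def] using ((hpow 1).mul_const (1 - q)).div hden one_ne_zero
    have hY : Tendsto (fun n : ℕ => (1 - q) / (1 - q ^ (n + 2))) atTop (𝓝 (1 - q)) := by
      simpa [Pi.div_def] using (tendsto_const_nhds (x := 1 - q)).div hden one_ne_zero
    exact (continuousAt_rogersAux_zero.tendsto.comp hX).add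
      ((continuousAt_rogersAux hq.le (by linarith)).tendsto.comp hY)
  have hB0 : B 0 - (rogersAux 0 + rogersAux (1 - q)) = rogersL q := by
    have hr := rogersAux_add_rogersAux_one_sub (x := q / (1 + q)) (y := q)
      ⟨by positivity, by rw [div_lt_one (by linarith)]; linarith⟩ ⟨h0, h1⟩
    have e1 : q ^ (0 + 1) * (1 - q) / (1 - q ^ (0 + 2)) = q / (1 + q) := by
      have : 1 - q ^ (0 + 2) = (1 - q) * (1 + q) := by ring
      rw [this]
      field_simp
      ring
    have e2 : (1 - q) / (1 - q ^ (0 + 2)) = 1 - q / (1 + q) := by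
      have : 1 - q ^ (0 + 2) = (1 - q) * (1 + q) := by ring
      rw [this]
      field_simp
      ring
    simp only [B, e1, e2, rogersAux_zero, rogersL_eq_rogersAux h1.ne]
    linarith
  rw [hasSum_iff_tendsto_nat_of_nonneg, ← hB0]
  · refine (hBlim.const_sub (B 0)).congr fun N => ?_
    rw [← Finset.sum_range_sub']
    refine Finset.sum_congr rfl fun n _ => ?_
    rw [rogersL_eq_rogersAux (hlt n).ne]
    exact (rogersAux_telescope h0 h1 (Nat.succ_ne_zero n)).symm
  · intro n
    rw [rogersL_eq_rogersAux (hlt n).ne]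
    exact rogersAux_nonneg (by positivity) (hlt n)

theorem coe_fib_two_mul (m : ℕ) :
    (Nat.fib (2 * m) : ℝ) =
      (Real.goldenRatio ^ (2 * m) - (Real.goldenRatio ^ (2 * m))⁻¹) / √5 := by
  have h : Real.goldenConj ^ (2 * m) = (Real.goldenRatio ^ (2 * m))⁻¹ := by
    rw [← inv_pow, Real.inv_goldenRatio, Even.neg_pow (even_two_mul m)]
  rw [Real.coe_fib_eq, h]

theorem fib_sq_div_fib_sq (k n : ℕ) (hk : 0 < k) :
    (Nat.fib (2 * k) : ℝ) ^ 2 / (Nat.fib (2 * k * (n + 2)) : ℝ) ^ 2 =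
      (1 / Real.goldenRatio ^ (4 * k)) ^ (n + 1) * (1 - 1 / Real.goldenRatio ^ (4 * k)) ^ 2 /
        (1 - (1 / Real.goldenRatio ^ (4 * k)) ^ (n + 2)) ^ 2 := by
  have hr1 : 1 < Real.goldenRatio ^ (2 * k) :=
    one_lt_pow₀ Real.one_lt_goldenRatio (by omega)
  have h4 : Real.goldenRatio ^ (4 * k) = (Real.goldenRatio ^ (2 * k)) ^ 2 := by
    rw [← pow_mul]; congr 1; ring
  rw [mul_assoc, coe_fib_two_mul, coe_fib_two_mul, ← mul_assoc, pow_mul _ (2 * k), h4]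
  generalize Real.goldenRatio ^ (2 * k) = r at hr1
  have hr : r ≠ 0 := by positivity
  have hR1 : 1 < r ^ (n + 2) := one_lt_pow₀ hr1 (by omega)
  have hq : (1 / r ^ 2) ^ (n + 1) = r ^ 2 / (r ^ (n + 2)) ^ 2 := by
    rw [one_div_pow, pow_succ r (n + 1), ← pow_mul, mul_comm 2, pow_mul]
    field_simp
  have hQ : (1 / r ^ 2) ^ (n + 2) = 1 / (r ^ (n + 2)) ^ 2 := by
    rw [one_div_pow, pow_right_comm]
  rw [hq, hQ]
  generalize r ^ (n + 2) = R at hR1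
  have hR : R ≠ 0 := by positivity
  have hR2 : R ^ 2 - 1 ≠ 0 := by nlinarith
  have hD1 : R - R⁻¹ = (R ^ 2 - 1) / R := by field_simp
  have hD2 : 1 - 1 / R ^ 2 = (R ^ 2 - 1) / R ^ 2 := by field_simp
  rw [hD1, hD2]
  field_simp

theorem stmt_11 (k : ℕ) (hk : 0 < k) :
    ∑' n : ℕ, rogersL ((Nat.fib (2 * k) : ℝ) ^ 2 / (Nat.fib (2 * k * (n + 2)) : ℝ) ^ 2) =
      rogersL (1 / ((1 + Real.sqrt 5) / 2) ^ (4 * k)) := by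
  change _ = rogersL (1 / Real.goldenRatio ^ (4 * k))
  simp only [fib_sq_div_fib_sq k _ hk]
  have h1 : 1 < Real.goldenRatio ^ (4 * k) := one_lt_pow₀ Real.one_lt_goldenRatio (by omega)
  exact (hasSum_rogersL (by positivity) ((div_lt_one (by positivity)).2 h1)).tsum_eq
end
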